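/- arXiv:1301.4185 — 2 statements merged into one kernel-verified Lean document; each statement's English description precedes it below -/
import Mathlib

section
/- Let p, q be probability distributions on ℤ, let 0 < α, β < 1/2 and m, n ∈ ℤ be such that α ≤ p((−∞,m]) ≤ 1−α and β ≤ q((−∞,n]) ≤ 1−β. Let p₁ = p|_{(−∞,m]}/p((−∞,m]), p₂ = p|_{[m+1,∞)}/p([m+1,∞)), q₁ = q|_{(−∞,n]}/q((−∞,n]), q₂ = q|_{[n+1,∞)}/q([n+1,∞)). Then ‖q⋆p₁ − q⋆p₂‖₁ + ‖p⋆q₁ − p⋆q₂‖₁ ≥ 2(α + β). -/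
/-- `p` is a probability distribution on `ℤ`. -/
def IsPMF (p : ℤ → ℝ) : Prop := (∀ k, 0 ≤ p k) ∧ HasSum p 1

/-- Convolution of two distributions on `ℤ`. -/
noncomputable def conv (p q : ℤ → ℝ) : ℤ → ℝ := fun k => ∑' j, p j * q (k - j)

/-- `p((−∞,n])`, the total mass of `p` on `(−∞,n]`. -/
noncomputable def headMass (p : ℤ → ℝ) (n : ℤ) : ℝ := ∑' k, if k ≤ n then p k else 0

/-- `p([n+1,∞))`, the total mass of `p` on `[n+1,∞)`. -/
noncomputable def tailMass (p : ℤ → ℝ) (n : ℤ) : ℝ := ∑' k, if n + 1 ≤ k then p k else 0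

/-- The normalized restriction `p|_{(−∞,n]} / p((−∞,n])`. -/
noncomputable def headPart (p : ℤ → ℝ) (n : ℤ) : ℤ → ℝ :=
  fun k => if k ≤ n then p k / headMass p n else 0

/-- The normalized restriction `p|_{[n+1,∞)} / p([n+1,∞))`. -/
noncomputable def tailPart (p : ℤ → ℝ) (n : ℤ) : ℤ → ℝ :=
  fun k => if n + 1 ≤ k then p k / tailMass p n else 0

/-- The `ℓ₁`-distance of two functions on `ℤ`. -/
noncomputable def l1dist (f g : ℤ → ℝ) : ℝ := ∑' k, |f k - g k|

/-- threshold test function -/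
noncomputable def thr (s : ℤ) : ℤ → ℝ := fun k => if k ≤ s then 1 else -1

lemma thr_abs (s k : ℤ) : |thr s k| = 1 := by
  unfold thr; split_ifs <;> simp

/-- expectation of the test function under a product distribution -/
noncomputable def tst (s : ℤ) (u v : ℤ → ℝ) : ℝ :=
  ∑' z : ℤ × ℤ, thr s (z.1 + z.2) * (u z.1 * v z.2)

lemma prod_hasSum {u v : ℤ → ℝ} (hu : IsPMF u) (hv : IsPMF v) :
    HasSum (fun z : ℤ × ℤ => u z.1 * v z.2) 1 := by
  have hs := hu.2.summable.mul_of_nonneg hv.2.summable hu.1 hv.1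
  simpa using hu.2.mul hv.2 hs

lemma tst_summable (s : ℤ) {u v : ℤ → ℝ} (hu : IsPMF u) (hv : IsPMF v) :
    Summable (fun z : ℤ × ℤ => thr s (z.1 + z.2) * (u z.1 * v z.2)) := by
  apply Summable.of_norm_bounded (prod_hasSum hu hv).summable
  intro z
  rw [Real.norm_eq_abs, abs_mul, thr_abs, one_mul,
    abs_of_nonneg (mul_nonneg (hu.1 _) (hv.1 _))]

lemma tst_comm (s : ℤ) (u v : ℤ → ℝ) : tst s u v = tst s v u := by
  unfold tst
  rw [← (Equiv.prodComm ℤ ℤ).tsum_eq]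
  congr 1; ext z; simp [add_comm, mul_comm]

lemma tst_le (s : ℤ) {u v : ℤ → ℝ} (hu : IsPMF u) (hv : IsPMF v) : tst s u v ≤ 1 := by
  rw [← (prod_hasSum hu hv).tsum_eq]
  refine (tst_summable s hu hv).tsum_le_tsum (fun z => ?_) (prod_hasSum hu hv).summable
  have h0 := mul_nonneg (hu.1 z.1) (hv.1 z.2)
  have := (abs_le.1 (thr_abs s (z.1+z.2)).le).2
  nlinarith

lemma le_tst (s : ℤ) {u v : ℤ → ℝ} (hu : IsPMF u) (hv : IsPMF v) : -1 ≤ tst s u v := by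
  rw [← (prod_hasSum hu hv).neg.tsum_eq]
  refine (prod_hasSum hu hv).neg.summable.tsum_le_tsum (fun z => ?_) (tst_summable s hu hv)
  have h0 := mul_nonneg (hu.1 z.1) (hv.1 z.2)
  have := (abs_le.1 (thr_abs s (z.1+z.2)).le).1
  nlinarith

lemma tst_lin (s : ℤ) {u u₁ u₂ v : ℤ → ℝ} (hu₁ : IsPMF u₁) (hu₂ : IsPMF u₂) (hv : IsPMF v)
    (a b : ℝ) (h : ∀ k, u k = a * u₁ k + b * u₂ k) :
    tst s u v = a * tst s u₁ v + b * tst s u₂ v := by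
  unfold tst
  rw [← tsum_mul_left, ← tsum_mul_left, ← ((tst_summable s hu₁ hv).mul_left a).tsum_add
    ((tst_summable s hu₂ hv).mul_left b)]
  congr 1; ext z; rw [h]; ring

/-- change of variables -/
def shearE : ℤ × ℤ ≃ ℤ × ℤ where
  toFun z := (z.2, z.1 - z.2)
  invFun z := (z.1 + z.2, z.1)
  left_inv z := by ext <;> simp
  right_inv z := by ext <;> simp

lemma conv_hasSum (s : ℤ) {u v : ℤ → ℝ} (hu : IsPMF u) (hv : IsPMF v) :
    HasSum (fun k => thr s k * conv u v k) (tst s u v) := by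
  have h := (shearE.hasSum_iff (a := tst s u v)).2 (tst_summable s hu hv).hasSum
  have hs := h.summable
  refine h.prod_fiberwise (fun k => ?_)
  have h1 : Summable (fun j => thr s k * (u j * v (k - j))) := by
    have := hs.prod_factor k
    simpa only [shearE, Function.comp_def, Equiv.coe_fn_mk, add_sub_cancel] using this
  have h2 : Summable (fun j => u j * v (k - j)) := by
    have h3 := h1.mul_left (thr s k)
    refine h3.congr (fun j => ?_)
    have : thr s k * thr s k = 1 := by unfold thr; split_ifs <;> norm_num
    rw [← mul_assoc, this, one_mul]
  have := h2.hasSum.mul_left (thr s k)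
  simpa only [shearE, Function.comp_def, Equiv.coe_fn_mk, add_sub_cancel, conv] using this

lemma l1_ge (s : ℤ) {u v w : ℤ → ℝ} (hu : IsPMF u) (hv : IsPMF v) (hw : IsPMF w) :
    tst s u v - tst s u w ≤ l1dist (conv u v) (conv u w) := by
  have h := (conv_hasSum s hu hv).sub (conv_hasSum s hu hw)
  have e : ∀ k, |thr s k * conv u v k - thr s k * conv u w k| = |conv u v k - conv u w k| := by
    intro k; rw [← mul_sub, abs_mul, thr_abs, one_mul]
  have hs := h.summable.abs
  rw [← h.tsum_eq, l1dist]
  simp_rw [← e]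
  exact h.summable.tsum_le_tsum (fun k => le_abs_self _) hs

lemma head_summable {p : ℤ → ℝ} (hp : IsPMF p) (m : ℤ) :
    Summable (fun k => if k ≤ m then p k else 0) := by
  refine Summable.of_nonneg_of_le (fun k => ?_) (fun k => ?_) hp.2.summable <;>
  · have := hp.1 k
    split_ifs <;> simp [this]

lemma tail_summable {p : ℤ → ℝ} (hp : IsPMF p) (m : ℤ) :
    Summable (fun k => if m + 1 ≤ k then p k else 0) := by
  refine Summable.of_nonneg_of_le (fun k => ?_) (fun k => ?_) hp.2.summable <;>
  · have := hp.1 k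
    split_ifs <;> simp [this]

lemma mass_add {p : ℤ → ℝ} (hp : IsPMF p) (m : ℤ) : headMass p m + tailMass p m = 1 := by
  unfold headMass tailMass
  rw [← (head_summable hp m).tsum_add (tail_summable hp m), ← hp.2.tsum_eq]
  congr 1; ext k
  split_ifs <;> first | omega | simp

lemma head_pmf {p : ℤ → ℝ} (hp : IsPMF p) (m : ℤ) (h : 0 < headMass p m) :
    IsPMF (headPart p m) := by
  refine ⟨fun k => ?_, ?_⟩
  · unfold headPart
    split_ifs
    · exact div_nonneg (hp.1 k) h.le
    · exact le_rfl
  · have := (head_summable hp m).hasSum.div_const (headMass p m)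
    change HasSum _ (headMass p m / headMass p m) at this
    rw [div_self h.ne'] at this
    convert this using 2 with k
    unfold headPart; split_ifs <;> simp

lemma tail_pmf {p : ℤ → ℝ} (hp : IsPMF p) (m : ℤ) (h : 0 < tailMass p m) :
    IsPMF (tailPart p m) := by
  refine ⟨fun k => ?_, ?_⟩
  · unfold tailPart
    split_ifs
    · exact div_nonneg (hp.1 k) h.le
    · exact le_rfl
  · have := (tail_summable hp m).hasSum.div_const (tailMass p m)
    change HasSum _ (tailMass p m / tailMass p m) at this
    rw [div_self h.ne'] at this
    convert this using 2 with k
    unfold tailPart; split_ifs <;> simp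

lemma decomp (p : ℤ → ℝ) (m : ℤ) (h : 0 < headMass p m) (h' : 0 < tailMass p m) (k : ℤ) :
    p k = headMass p m * headPart p m k + tailMass p m * tailPart p m k := by
  unfold headPart tailPart
  split_ifs
  · omega
  · field_simp; simp
  · field_simp; simp
  · omega

lemma tst_head {p q : ℤ → ℝ} (m n : ℤ) (hp : IsPMF (headPart p m)) (hq : IsPMF (headPart q n)) :
    tst (m + n) (headPart p m) (headPart q n) = 1 := by
  rw [← (prod_hasSum hp hq).tsum_eq, tst]
  congr 1; ext z
  unfold thr headPart
  split_ifs <;> first | omega | simp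

lemma tst_tail {p q : ℤ → ℝ} (m n : ℤ) (hp : IsPMF (tailPart p m)) (hq : IsPMF (tailPart q n)) :
    tst (m + n) (tailPart p m) (tailPart q n) = -1 := by
  rw [← (prod_hasSum hp hq).neg.tsum_eq, tst]
  congr 1; ext z
  unfold thr tailPart
  split_ifs <;> first | omega | simp


/-- if `0 < α, β < 1/2`, `α ≤ p((−∞,m]) ≤ 1−α` and `β ≤ q((−∞,n]) ≤ 1−β`,
then `‖q⋆p₁ − q⋆p₂‖₁ + ‖p⋆q₁ − p⋆q₂‖₁ ≥ 2(α+β)` for the normalized restrictions. -/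
theorem stmt13 (p q : ℤ → ℝ) (α β : ℝ) (m n : ℤ) (hp : IsPMF p) (hq : IsPMF q)
    (hα₀ : 0 < α) (hα₁ : α < 1 / 2) (hβ₀ : 0 < β) (hβ₁ : β < 1 / 2)
    (hpm₁ : α ≤ headMass p m) (hpm₂ : headMass p m ≤ 1 - α)
    (hqn₁ : β ≤ headMass q n) (hqn₂ : headMass q n ≤ 1 - β) :
    l1dist (conv q (headPart p m)) (conv q (tailPart p m)) +
      l1dist (conv p (headPart q n)) (conv p (tailPart q n)) ≥ 2 * (α + β) := by
  have ea := mass_add hp m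
  have eb := mass_add hq n
  have a0 : 0 < headMass p m := by linarith
  have a1 : 0 < tailMass p m := by linarith
  have b0 : 0 < headMass q n := by linarith
  have b1 : 0 < tailMass q n := by linarith
  have P1 := head_pmf hp m a0
  have P2 := tail_pmf hp m a1
  have Q1 := head_pmf hq n b0
  have Q2 := tail_pmf hq n b1
  have dp := decomp p m a0 a1
  have dq := decomp q n b0 b1
  have L1 := l1_ge (m + n) hq P1 P2
  have L2 := l1_ge (m + n) hp Q1 Q2
  rw [tst_lin (m + n) Q1 Q2 P1 _ _ dq, tst_lin (m + n) Q1 Q2 P2 _ _ dq,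
    tst_comm _ (headPart q n), tst_comm _ (tailPart q n), tst_comm _ (headPart q n),
    tst_comm _ (tailPart q n), tst_head m n P1 Q1, tst_tail m n P2 Q2] at L1
  rw [tst_lin (m + n) P1 P2 Q1 _ _ dp, tst_lin (m + n) P1 P2 Q2 _ _ dp,
    tst_head m n P1 Q1, tst_tail m n P2 Q2] at L2
  have x1 := tst_le (m + n) P2 Q1
  have x2 := le_tst (m + n) P2 Q1
  have y1 := tst_le (m + n) P1 Q2
  have y2 := le_tst (m + n) P1 Q2
  generalize tst (m + n) (tailPart p m) (headPart q n) = x at *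
  generalize tst (m + n) (headPart p m) (tailPart q n) = y at *
  have ta : tailMass p m = 1 - headMass p m := by linarith
  have tb : tailMass q n = 1 - headMass q n := by linarith
  rw [tb] at L1
  rw [ta] at L2
  rcases le_total 0 (1 - headMass p m - headMass q n) with h | h
  · nlinarith [mul_nonneg h (by linarith : 0 ≤ x + y + 2)]
  · nlinarith [mul_nonneg (neg_nonneg.2 h) (by linarith : 0 ≤ 2 - (x + y))]
end

section
/- Let p and q be probability distributions on ℤ with finite entropies H(p) = c, H(q) = d, and let x = ‖p‖_∞, y = ‖q‖_∞. Then 2·H(p⋆q) − c − d ≥ l(x,y), where l(x,y) = min_{(a,b)∈T(x,y)} ((1−x)²a² + (1−y)²b²)/(8 ln 2) and T(x,y) = {(a,b) ∈ ℝ₊² : a ≥ (4y−2)⁺, b ≥ (4x−2)⁺, a+b ≥ 2−x−y}. Moreover l is a continuous function on [0,1]², l(x,y) ≥ 0, and l(x,y) = 0 if and only if (x,y) = (1,1). -/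
/-- Shannon entropy (in bits) of a distribution on `ℤ`. -/
noncomputable def entH (p : ℤ → ℝ) : ℝ := ∑' k, -(p k * Real.logb 2 (p k))

/-- The constraint set `T(x,y) = {(a,b) ∈ ℝ₊² : a ≥ (4y−2)⁺, b ≥ (4x−2)⁺, a+b ≥ 2−x−y}`. -/
def Tset (x y : ℝ) : Set (ℝ × ℝ) :=
  {ab | 0 ≤ ab.1 ∧ 0 ≤ ab.2 ∧ max (4 * y - 2) 0 ≤ ab.1 ∧ max (4 * x - 2) 0 ≤ ab.2 ∧
    2 - x - y ≤ ab.1 + ab.2}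

/-- `l(x,y) = min_{(a,b) ∈ T(x,y)} ((1−x)²a² + (1−y)²b²)/(8 ln 2)`. -/
noncomputable def lfun (x y : ℝ) : ℝ :=
  sInf ((fun ab : ℝ × ℝ => ((1 - x) ^ 2 * ab.1 ^ 2 + (1 - y) ^ 2 * ab.2 ^ 2) / (8 * Real.log 2))
    '' Tset x y)

open Real

lemma conv_aux {p h : ℤ → ℝ} (hp : ∀ k, 0 ≤ p k) (hh : ∀ k, 0 ≤ h k) {A B : ℝ}
    (hA : HasSum p A) (hB : HasSum h B) :
    (∀ k, HasSum (fun j => p j * h (k - j)) (conv p h k)) ∧ HasSum (conv p h) (A * B) := by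
  have hs : Summable fun x : ℤ × ℤ => p x.1 * h x.2 :=
    Summable.mul_of_nonneg hA.summable hB.summable hp hh
  have h1 : HasSum (fun x : ℤ × ℤ => p x.1 * h x.2) (A * B) := hA.mul hB hs
  let e : ℤ × ℤ ≃ ℤ × ℤ :=
    { toFun := fun x => (x.2, x.1 - x.2)
      invFun := fun x => (x.1 + x.2, x.1)
      left_inv := fun x => by ext <;> simp
      right_inv := fun x => by ext <;> simp }
  have h2 : HasSum (fun x : ℤ × ℤ => p x.2 * h (x.1 - x.2)) (A * B) :=
    (e.hasSum_iff (f := fun x : ℤ × ℤ => p x.1 * h x.2)).2 h1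
  have h3 : ∀ k, HasSum (fun j => p j * h (k - j)) (conv p h k) := fun k =>
    (h2.summable.prod_factor k).hasSum
  exact ⟨h3, h2.prod_fiberwise h3⟩

lemma conv_nonneg {p h : ℤ → ℝ} (hp : ∀ k, 0 ≤ p k) (hh : ∀ k, 0 ≤ h k) (k : ℤ) :
    0 ≤ conv p h k := tsum_nonneg fun j => mul_nonneg (hp j) (hh _)

lemma conv_pmf {p q : ℤ → ℝ} (hp : IsPMF p) (hq : IsPMF q) : IsPMF (conv p q) :=
  ⟨conv_nonneg hp.1 hq.1, by simpa using (conv_aux hp.1 hq.1 hp.2 hq.2).2⟩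

lemma conv_comm' (p q : ℤ → ℝ) : conv p q = conv q p := by
  funext k
  unfold conv
  rw [← (Equiv.subLeft k).tsum_eq]
  apply tsum_congr
  intro j
  simp [mul_comm]

lemma pmf_le_one {p : ℤ → ℝ} (hp : IsPMF p) (k : ℤ) : p k ≤ 1 :=
  le_hasSum hp.2 k fun j _ => hp.1 j

lemma eta_nonneg {p : ℤ → ℝ} (hp : IsPMF p) (k : ℤ) : 0 ≤ negMulLog (p k) :=
  negMulLog_nonneg (hp.1 k) (pmf_le_one hp k)

lemma eta_tangent {t r : ℝ} (ht : 0 ≤ t) (hr : 0 < r) :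
    negMulLog t ≤ r - t - t * log r := by
  rcases ht.eq_or_lt with rfl | ht
  · simp [hr.le]
  have h := log_le_sub_one_of_pos (div_pos hr ht)
  rw [log_div hr.ne' ht.ne'] at h
  have h2 := mul_le_mul_of_nonneg_left h ht.le
  have h3 : t * (r / t - 1) = r - t := by field_simp
  rw [h3] at h2
  unfold negMulLog
  linarith

/-- Jensen -/
lemma conv_eta {p q : ℤ → ℝ} (hp : IsPMF p) (hq : IsPMF q) (k : ℤ) :
    conv p (fun i => negMulLog (q i)) k ≤ negMulLog (conv p q k) := by
  have hf := (conv_aux hp.1 hq.1 hp.2 hq.2).1 k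
  have hbd : ∀ j, negMulLog (q j) ≤ 1 := fun j => by
    have := eta_tangent (hq.1 j) one_pos
    have := hq.1 j
    simp at *; linarith
  have hs : Summable fun j => p j * negMulLog (q (k - j)) :=
    Summable.of_nonneg_of_le (fun j => mul_nonneg (hp.1 j) (eta_nonneg hq _))
      (fun j => mul_le_of_le_one_right (hp.1 j) (hbd _)) hp.2.summable
  rcases (conv_nonneg hp.1 hq.1 k).eq_or_lt with h0 | h0
  · rw [← h0] at hf
    have h1 := (hasSum_zero_iff_of_nonneg (fun j => mul_nonneg (hp.1 j) (hq.1 _))).1 hf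
    rw [← h0]
    simp only [negMulLog_zero]
    apply le_of_eq
    unfold conv
    rw [← tsum_zero (α := ℝ) (β := ℤ)]
    apply tsum_congr
    intro j
    have := congrFun h1 j
    simp only [Pi.zero_apply, mul_eq_zero] at this
    rcases this with h | h <;> simp [h]
  · set r := conv p q k
    have h2 : HasSum (fun j => r * p j - p j * q (k - j) - log r * (p j * q (k - j)))
        (r * 1 - r - log r * r) := ((hp.2.mul_left r).sub hf).sub (hf.mul_left _)
    have h3 := hasSum_le (fun j => ?_) hs.hasSum h2
    · unfold conv
      unfold negMulLog at *
      linarith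
    · have := mul_le_mul_of_nonneg_left (eta_tangent (hq.1 (k - j)) h0) (hp.1 j)
      linarith

lemma conv_eta_upper {p q : ℤ → ℝ} (hp : IsPMF p) (hq : IsPMF q) {c d : ℝ}
    (hc : HasSum (fun k => negMulLog (p k)) c) (hd : HasSum (fun k => negMulLog (q k)) d) :
    Summable fun k => negMulLog (conv p q k) := by
  have h1 := conv_aux (eta_nonneg hp) hq.1 hc hq.2
  have h2 := conv_aux hp.1 (eta_nonneg hq) hp.2 hd
  have h0 := conv_aux hp.1 hq.1 hp.2 hq.2
  refine Summable.of_nonneg_of_le (eta_nonneg (conv_pmf hp hq)) (fun k => ?_)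
    (h1.2.add h2.2).summable
  have h3 := (h0.1 k).mul_left (-log (conv p q k))
  have h4 := hasSum_le (fun j => ?_) h3 ((h1.1 k).add (h2.1 k))
  · unfold negMulLog at *; linarith
  · have hle : p j * q (k - j) ≤ conv p q k :=
      le_hasSum (h0.1 k) j fun i _ => mul_nonneg (hp.1 i) (hq.1 _)
    rcases (mul_nonneg (hp.1 j) (hq.1 (k - j))).eq_or_lt with h | h
    · rw [← h]
      simp only [mul_zero]
      exact add_nonneg (mul_nonneg (eta_nonneg hp j) (hq.1 _))
        (mul_nonneg (hp.1 j) (eta_nonneg hq _))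
    · have hl := log_le_log h hle
      have := negMulLog_mul (p j) (q (k - j))
      have h5 := mul_le_mul_of_nonneg_left hl h.le
      have h6 : negMulLog (p j * q (k - j)) = - (p j * q (k - j)) * log (p j * q (k - j)) := rfl
      rw [h6] at this
      linarith

lemma exp_key (s : ℝ) : exp (s - s ^ 2 / 6) ≤ 1 + s + s ^ 2 / 3 := by
  have hD : ∀ t : ℝ, 0 < 1 + t + t ^ 2 / 3 := fun t => by nlinarith [sq_nonneg (t + 3 / 2)]
  let F : ℝ → ℝ := fun t => log (1 + t + t ^ 2 / 3) - t + t ^ 2 / 6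
  have hF : ∀ t, HasDerivAt F (t ^ 3 / 9 / (1 + t + t ^ 2 / 3)) t := fun t => by
    have h1 : HasDerivAt (fun t : ℝ => 1 + t + t ^ 2 / 3) (1 + 2 * t / 3) t := by
      have := ((hasDerivAt_id' t).const_add 1).add ((hasDerivAt_pow 2 t).div_const 3)
      exact this.congr_deriv (by simp)
    have h2 : HasDerivAt (fun t : ℝ => t ^ 2 / 6) (2 * t / 6) t := by
      have := ((hasDerivAt_pow 2 t).div_const 6)
      exact this.congr_deriv (by simp)
    have h3 := ((h1.log (hD t).ne').sub (hasDerivAt_id' t)).add h2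
    refine h3.congr_deriv ?_
    rw [eq_div_iff (hD t).ne']
    have h4 := div_mul_cancel₀ (1 + 2 * t / 3) (hD t).ne'
    linear_combination h4
  have hF0 : F 0 = 0 := by simp [F]
  have hcont : Continuous F := continuous_iff_continuousAt.2 fun t => (hF t).continuousAt
  have hpos : 0 ≤ F s := by
    rcases le_total 0 s with h | h
    · have hm : MonotoneOn F (Set.Ici 0) := monotoneOn_of_deriv_nonneg (convex_Ici 0)
        hcont.continuousOn (fun t _ => (hF t).differentiableAt.differentiableWithinAt)
        (fun t ht => by
          rw [interior_Ici] at ht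
          rw [(hF t).deriv]
          have : (0:ℝ) ≤ t := le_of_lt ht
          have := hD t
          positivity)
      rw [← hF0]; exact hm Set.self_mem_Ici h h
    · have hm : AntitoneOn F (Set.Iic 0) := antitoneOn_of_deriv_nonpos (convex_Iic 0)
        hcont.continuousOn (fun t _ => (hF t).differentiableAt.differentiableWithinAt)
        (fun t ht => by
          rw [interior_Iic] at ht
          rw [(hF t).deriv]
          have h1 : t < 0 := ht
          apply div_nonpos_of_nonpos_of_nonneg _ (hD t).le
          have : t ^ 3 ≤ 0 := by nlinarith [sq_nonneg t]
          linarith)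
      rw [← hF0]; exact hm h Set.self_mem_Iic h
  rw [← le_log_iff_exp_le (hD s)]
  simp only [F] at hpos
  linarith

lemma pinsker_term {u r : ℝ} (s : ℝ) (hu : 0 ≤ u) (hr : 0 < r) :
    s * (u - r) - s ^ 2 * (u + 2 * r) / 6 ≤ - negMulLog u - u * log r - u + r := by
  have h1 := eta_tangent hu (mul_pos hr (exp_pos (s - s ^ 2 / 6)))
  rw [log_mul hr.ne' (exp_pos _).ne', log_exp] at h1
  have h2 := mul_le_mul_of_nonneg_left (exp_key s) hr.le
  nlinarith

lemma G_term {u v α : ℝ} (lam : ℝ) (hu : 0 ≤ u) (hv : 0 ≤ v) (h0 : 0 ≤ α) (h1 : α ≤ 1) :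
    α * (1 - α) * (lam * |u - v| - lam ^ 2 / 6 *
      ((1 - α) * u + α * v + 2 * (α * u + (1 - α) * v))) ≤
    negMulLog (α * u + (1 - α) * v) - (α * negMulLog u + (1 - α) * negMulLog v) := by
  rcases h0.eq_or_lt with rfl | h0
  · simp
  rcases h1.eq_or_lt with rfl | h1
  · simp
  have h1' : 0 < 1 - α := by linarith
  set r := α * u + (1 - α) * v with hr
  rcases (show 0 ≤ r by positivity).eq_or_lt with hr0 | hr0
  · have ha : α * u = 0 := by nlinarith [mul_nonneg h0.le hu, mul_nonneg h1'.le hv]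
    have hb : (1 - α) * v = 0 := by nlinarith [mul_nonneg h0.le hu, mul_nonneg h1'.le hv]
    have hu0 : u = 0 := by simpa [h0.ne'] using ha
    have hv0 : v = 0 := by simpa [h1'.ne'] using hb
    rw [← hr0]; simp [hu0, hv0]
  · obtain ⟨σ, hσ, hσ2⟩ : ∃ σ : ℝ, σ * (u - v) = |u - v| ∧ σ ^ 2 = 1 := by
      rcases abs_cases (u - v) with ⟨h, _⟩ | ⟨h, _⟩
      · exact ⟨1, by rw [h]; ring, by norm_num⟩
      · exact ⟨-1, by rw [h]; ring, by norm_num⟩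
    have ha := mul_le_mul_of_nonneg_left (pinsker_term ((1 - α) * lam * σ) hu hr0) h0.le
    have hb := mul_le_mul_of_nonneg_left (pinsker_term (-(α * lam * σ)) hv hr0) h1'.le
    have e1 : u - r = (1 - α) * (u - v) := by rw [hr]; ring
    have e2 : v - r = -(α * (u - v)) := by rw [hr]; ring
    have e3 : negMulLog r = - (α * u * log r + (1 - α) * v * log r) := by
      unfold negMulLog; nth_rewrite 1 [hr]; ring
    rw [e3]
    have e4 : α * ((1 - α) * lam * σ * (u - r) - ((1 - α) * lam * σ) ^ 2 * (u + 2 * r) / 6)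
       = α * (1 - α) * ((1 - α) * (lam * |u - v|) - lam ^ 2 / 6 * ((1 - α) * (u + 2 * r))) := by
      rw [e1, ← hσ, mul_pow _ σ, hσ2]; ring
    have e5 : (1 - α) * (-(α * lam * σ) * (v - r) - (-(α * lam * σ)) ^ 2 * (v + 2 * r) / 6)
       = α * (1 - α) * (α * (lam * |u - v|) - lam ^ 2 / 6 * (α * (v + 2 * r))) := by
      rw [e2, ← hσ, neg_sq, mul_pow _ σ, hσ2]; ring
    rw [e4] at ha
    rw [e5] at hb
    have e6 : α * (- negMulLog u - u * log r - u + r) + (1 - α) * (- negMulLog v - v * log r - v + r)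
      = -(α * u * log r + (1 - α) * v * log r) - (α * negMulLog u + (1 - α) * negMulLog v) := by
      have : α * u + (1 - α) * v = r := hr.symm
      linear_combination (-1 : ℝ) * this
    rw [← e6]
    refine le_trans (le_of_eq ?_) (add_le_add ha hb)
    ring

structure Split (p : ℤ → ℝ) (α : ℝ) (p1 p2 : ℤ → ℝ) (m : ℤ) : Prop where
  h1 : IsPMF p1
  h2 : IsPMF p2
  a0 : 0 ≤ α
  a1 : α ≤ 1
  eq : ∀ k, p k = α * p1 k + (1 - α) * p2 k
  s1 : ∀ k, m < k → p1 k = 0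
  s2 : ∀ k, k ≤ m → p2 k = 0

lemma conv_split {p p1 p2 h : ℤ → ℝ} {α B : ℝ} {m : ℤ} (S : Split p α p1 p2 m)
    (hh : ∀ k, 0 ≤ h k) (hB : HasSum h B) (k : ℤ) :
    conv p h k = α * conv p1 h k + (1 - α) * conv p2 h k := by
  have ha := (conv_aux S.h1.1 hh S.h1.2 hB).1 k
  have hb := (conv_aux S.h2.1 hh S.h2.2 hB).1 k
  have := (ha.mul_left α).add (hb.mul_left (1 - α))
  rw [← this.tsum_eq]
  unfold conv
  apply tsum_congr
  intro j
  rw [S.eq]; ring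

noncomputable def L1 (u v : ℤ → ℝ) : ℝ := ∑' k, |u k - v k|

lemma L1_hasSum {u v : ℤ → ℝ} (hu : IsPMF u) (hv : IsPMF v) :
    HasSum (fun k => |u k - v k|) (L1 u v) :=
  (hu.2.summable.sub hv.2.summable).abs.hasSum

lemma ent_diff {p q p1 p2 : ℤ → ℝ} {α d : ℝ} {m : ℤ} (hp : IsPMF p) (hq : IsPMF q)
    (S : Split p α p1 p2 m)
    (hd : HasSum (fun k => negMulLog (q k)) d)
    (hs : Summable fun k => negMulLog (conv p q k)) :
    α * (1 - α) * (L1 (conv p1 q) (conv p2 q)) ^ 2 / 2 ≤ ∑' k, negMulLog (conv p q k) - d := by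
  have hu := conv_pmf S.h1 hq
  have hv := conv_pmf S.h2 hq
  set u := conv p1 q
  set v := conv p2 q
  set a := L1 u v
  have a1 : 0 ≤ 1 - α := by linarith [S.a1]
  have e : ∀ k, conv p q k = α * u k + (1 - α) * v k := conv_split S hq.1 hq.2
  have hw : HasSum (fun k => α * (1 - α) * (a * |u k - v k| - a ^ 2 / 6 *
      ((1 - α) * u k + α * v k + 2 * (α * u k + (1 - α) * v k))))
      (α * (1 - α) * (a * a - a ^ 2 / 6 *
      ((1 - α) * 1 + α * 1 + 2 * (α * 1 + (1 - α) * 1)))) := by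
    refine HasSum.mul_left _ (((L1_hasSum hu hv).mul_left a).sub (HasSum.mul_left _ ?_))
    exact ((hu.2.mul_left _).add (hv.2.mul_left _)).add
      (((hu.2.mul_left _).add (hv.2.mul_left _)).mul_left 2)
  have hq' : HasSum (conv p (fun i => negMulLog (q i))) d := by
    simpa using (conv_aux hp.1 (eta_nonneg hq) hp.2 hd).2
  have := hasSum_le (fun k => ?_) (hw.add hq') hs.hasSum
  · have e2 : (α * (1 - α) * (a * a - a ^ 2 / 6 *
      ((1 - α) * 1 + α * 1 + 2 * (α * 1 + (1 - α) * 1)))) = α * (1 - α) * a ^ 2 / 2 := by ring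
    rw [e2] at this
    linarith
  · have g := G_term a (hu.1 k) (hv.1 k) S.a0 S.a1
    have j1 := mul_le_mul_of_nonneg_left (conv_eta S.h1 hq k) S.a0
    have j2 := mul_le_mul_of_nonneg_left (conv_eta S.h2 hq k) a1
    have j3 := conv_split S (eta_nonneg hq) hd k
    rw [e k]
    simp only [u, v] at *
    linarith

noncomputable def gN (N k : ℤ) : ℝ := if k ≤ N then 1 else -1

lemma gN_abs (N k : ℤ) : |gN N k| = 1 := by unfold gN; split_ifs <;> simp

noncomputable def EN (u : ℤ → ℝ) (N : ℤ) : ℝ := ∑' k, gN N k * u k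

lemma EN_hasSum {u : ℤ → ℝ} (hu : IsPMF u) (N : ℤ) :
    HasSum (fun k => gN N k * u k) (EN u N) := by
  apply Summable.hasSum
  apply Summable.of_norm_bounded hu.2.summable
  intro k
  rw [norm_mul, norm_eq_abs, gN_abs, one_mul, norm_eq_abs, abs_of_nonneg (hu.1 k)]

lemma EN_le {u : ℤ → ℝ} (hu : IsPMF u) (N : ℤ) : |EN u N| ≤ 1 := by
  rw [abs_le]
  constructor
  · refine hasSum_le (fun k => ?_) hu.2.neg (EN_hasSum hu N)
    have := hu.1 k
    unfold gN; split_ifs <;> linarith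
  · refine hasSum_le (fun k => ?_) (EN_hasSum hu N) hu.2
    have := hu.1 k
    unfold gN; split_ifs <;> linarith

lemma EN_sub_le {u v : ℤ → ℝ} (hu : IsPMF u) (hv : IsPMF v) (N : ℤ) :
    EN u N - EN v N ≤ L1 u v := by
  refine hasSum_le (fun k => ?_) ((EN_hasSum hu N).sub (EN_hasSum hv N)) (L1_hasSum hu hv)
  rw [← mul_sub]
  exact (le_abs_self _).trans (by rw [abs_mul, gN_abs, one_mul])

lemma EN_split {p p1 p2 h : ℤ → ℝ} {α : ℝ} {m : ℤ} (S : Split p α p1 p2 m)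
    (hh : IsPMF h) (N : ℤ) :
    EN (conv p h) N = α * EN (conv p1 h) N + (1 - α) * EN (conv p2 h) N := by
  have := ((EN_hasSum (conv_pmf S.h1 hh) N).mul_left α).add
    ((EN_hasSum (conv_pmf S.h2 hh) N).mul_left (1 - α))
  rw [← this.tsum_eq]
  unfold EN
  apply tsum_congr
  intro j
  rw [conv_split S hh.1 hh.2]; ring

lemma term_le_conv {p q : ℤ → ℝ} (hp : IsPMF p) (hq : IsPMF q) (k j : ℤ) :
    p (k - j) * q j ≤ conv p q k := by
  have := le_hasSum ((conv_aux hp.1 hq.1 hp.2 hq.2).1 k) (k - j)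
    fun i _ => mul_nonneg (hp.1 i) (hq.1 _)
  simpa using this

lemma EN_spike {p p1 p2 q : ℤ → ℝ} {α : ℝ} {m : ℤ} (S : Split p α p1 p2 m)
    (hq : IsPMF q) (j : ℤ) : 4 * q j - 2 ≤ L1 (conv p1 q) (conv p2 q) := by
  have hu := conv_pmf S.h1 hq
  have hv := conv_pmf S.h2 hq
  have sh : ∀ f : ℤ → ℝ, HasSum f 1 → HasSum (fun k => 2 * (f (k - j) * q j)) (2 * (1 * q j)) :=
    fun f hf => (((Equiv.subRight j).hasSum_iff (f := f)).2 hf |>.mul_right _).mul_left _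
  have k1 : 2 * (1 * q j) ≤ EN (conv p1 q) (m + j) + 1 := by
    refine hasSum_le (fun k => ?_) (sh _ S.h1.2) ((EN_hasSum hu (m + j)).add hu.2)
    have := term_le_conv S.h1 hq k j
    have := hu.1 k
    unfold gN; split_ifs with hk
    · linarith
    · rw [S.s1 (k - j) (by omega)]; linarith
  have k2 : 2 * (1 * q j) ≤ 1 - EN (conv p2 q) (m + j) := by
    refine hasSum_le (fun k => ?_) (sh _ S.h2.2) (hv.2.sub (EN_hasSum hv (m + j)))
    have := term_le_conv S.h2 hq k j
    have := hv.1 k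
    unfold gN; split_ifs with hk
    · rw [S.s2 (k - j) (by omega)]; linarith
    · linarith
  have := EN_sub_le hu hv (m + j)
  linarith

lemma EN_left {p q : ℤ → ℝ} {m n : ℤ} (hp : IsPMF p) (hq : IsPMF q)
    (s : ∀ k, m < k → p k = 0) (t : ∀ k, n < k → q k = 0) : EN (conv p q) (m + n) = 1 := by
  have hu := conv_pmf hp hq
  refine HasSum.unique ?_ hu.2
  convert EN_hasSum hu (m + n) using 2 with k
  unfold gN; split_ifs with hk
  · ring
  · have : conv p q k = 0 := by
      unfold conv
      rw [← tsum_zero (α := ℝ) (β := ℤ)]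
      apply tsum_congr
      intro j
      rcases lt_or_ge m j with h | h
      · rw [s j h, zero_mul]
      · rw [t (k - j) (by omega), mul_zero]
    rw [this]; ring

lemma EN_right {p q : ℤ → ℝ} {m n : ℤ} (hp : IsPMF p) (hq : IsPMF q)
    (s : ∀ k, k ≤ m → p k = 0) (t : ∀ k, k ≤ n → q k = 0) : EN (conv p q) (m + n) = -1 := by
  have hu := conv_pmf hp hq
  refine HasSum.unique (EN_hasSum hu (m + n)) ?_
  have hfun : (fun k => gN (m + n) k * conv p q k) = fun k => -conv p q k := by
    funext k
    unfold gN; split_ifs with hk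
    · have : conv p q k = 0 := by
        unfold conv
        rw [← tsum_zero (α := ℝ) (β := ℤ)]
        apply tsum_congr
        intro j
        rcases le_or_gt j m with h | h
        · rw [s j h, zero_mul]
        · rw [t (k - j) (by omega), mul_zero]
      rw [this]; ring
    · ring
  rw [hfun]
  exact hu.2.neg

lemma L1_sum {p p1 p2 q q1 q2 : ℤ → ℝ} {α β x y : ℝ} {m n : ℤ} (hp : IsPMF p) (hq : IsPMF q)
    (S : Split p α p1 p2 m) (T : Split q β q1 q2 n)
    (ha : (1 - x) / 2 ≤ α) (ha' : α ≤ (1 + x) / 2)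
    (hb : (1 - y) / 2 ≤ β) (hb' : β ≤ (1 + y) / 2) :
    2 - x - y ≤ L1 (conv p1 q) (conv p2 q) + L1 (conv q1 p) (conv q2 p) := by
  have k1 := EN_sub_le (conv_pmf S.h1 hq) (conv_pmf S.h2 hq) (m + n)
  have k2 := EN_sub_le (conv_pmf T.h1 hp) (conv_pmf T.h2 hp) (m + n)
  rw [conv_comm' p1 q, conv_comm' p2 q, EN_split T S.h1, EN_split T S.h2] at k1
  rw [conv_comm' q1 p, conv_comm' q2 p, EN_split S T.h1, EN_split S T.h2] at k2
  rw [conv_comm' q1 p1, conv_comm' q1 p2, conv_comm' q2 p1, conv_comm' q2 p2] at k1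
  rw [EN_left S.h1 T.h1 S.s1 T.s1, EN_right S.h2 T.h2 S.s2 T.s2] at k1 k2
  rw [conv_comm' p1 q, conv_comm' p2 q, conv_comm' q1 p, conv_comm' q2 p]
  have b1 := abs_le.1 (EN_le (conv_pmf S.h1 T.h2) (m + n))
  have b2 := abs_le.1 (EN_le (conv_pmf S.h2 T.h1) (m + n))
  set A := EN (conv p1 q2) (m + n)
  set B := EN (conv p2 q1) (m + n)
  have : -(x + y) ≤ (1 - α - β) * (A + B) := by
    rcases le_total 0 (1 - α - β) with h | h <;> nlinarith
  linarith

noncomputable def delta (m k : ℤ) : ℝ := if k = m then 1 else 0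

lemma delta_pmf (m : ℤ) : IsPMF (delta m) :=
  ⟨fun k => by unfold delta; split_ifs <;> simp, hasSum_ite_eq m 1⟩

lemma normalize_aux {f : ℤ → ℝ} {α : ℝ} (hf : ∀ k, 0 ≤ f k) (hs : HasSum f α) (m : ℤ) :
    ∃ g, IsPMF g ∧ (∀ k, f k = α * g k) ∧ (∀ k, k ≠ m → f k = 0 → g k = 0) := by
  rcases (hs.nonneg hf).eq_or_lt with h | h
  · subst h
    have h1 := (hasSum_zero_iff_of_nonneg hf).1 hs
    refine ⟨delta m, delta_pmf m, fun k => by simp [h1], fun k hk _ => by simp [delta, hk]⟩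
  · refine ⟨fun k => f k / α, ⟨fun k => div_nonneg (hf k) h.le, ?_⟩, fun k => ?_, fun k _ h => ?_⟩
    · simpa [h.ne'] using hs.div_const α
    · field_simp
    · simp [h]

lemma exists_split {p : ℤ → ℝ} (hp : IsPMF p) {x : ℝ} (hx : ∀ k, p k ≤ x) :
    ∃ α p1 p2 m, Split p α p1 p2 m ∧ (1 - x) / 2 ≤ α ∧ α ≤ (1 + x) / 2 := by
  have hx0 : 0 ≤ x := (hp.1 0).trans (hx 0)
  let f : ℤ → ℤ → ℝ := fun m k => if k ≤ m then p k else 0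
  have hfs : ∀ m, Summable (f m) := fun m => Summable.of_nonneg_of_le
    (fun k => by simp only [f]; split_ifs; exacts [hp.1 k, le_rfl])
    (fun k => by simp only [f]; split_ifs; exacts [le_rfl, hp.1 k]) hp.2.summable
  let F : ℤ → ℝ := fun m => ∑' k, f m k
  have hF : ∀ m, HasSum (f m) (F m) := fun m => (hfs m).hasSum
  have hstep : ∀ m, F m = F (m - 1) + p m := fun m => by
    refine HasSum.unique (hF m) ?_
    have := (hF (m - 1)).add (hasSum_ite_eq m (p m))
    convert this using 2 with k
    simp only [f]
    by_cases h1 : k = m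
    · subst h1; simp
    · by_cases h2 : k ≤ m
      · rw [if_pos h2, if_pos (by omega), if_neg h1, add_zero]
      · rw [if_neg h2, if_neg (by omega), if_neg h1, add_zero]
  have hmono : ∀ m n, m ≤ n → F m ≤ F n := fun m n h => hasSum_le (fun k => by
    simp only [f]; split_ifs
    · exact le_rfl
    · omega
    · exact hp.1 k
    · exact le_rfl) (hF m) (hF n)
  -- a finite set with mass > 1/2
  obtain ⟨s, hs⟩ : ∃ s : Finset ℤ, 1 / 2 < ∑ k ∈ s, p k := by
    have := hp.2.eventually (lt_mem_nhds (show (1 / 2 : ℝ) < 1 by norm_num))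
    exact this.exists
  obtain ⟨M, hM⟩ := s.bddAbove
  obtain ⟨K, hK⟩ := s.bddBelow
  have hup : 1 / 2 ≤ F M := by
    refine hs.le.trans (le_trans (le_of_eq ?_)
      (sum_le_hasSum s (fun k _ => ?_) (hF M)))
    · apply Finset.sum_congr rfl
      intro k hk
      simp only [f]; rw [if_pos (hM hk)]
    · simp only [f]; split_ifs; exacts [hp.1 k, le_rfl]
  have hlow : ∀ m, 1 / 2 ≤ F m → K ≤ m := fun m hm => by
    by_contra hlt
    have h1 : HasSum (fun k => p k - f m k) (1 - F m) := hp.2.sub (hF m)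
    have : ∑ k ∈ s, p k ≤ 1 - F m := by
      refine le_trans (le_of_eq ?_) (sum_le_hasSum s (fun k _ => ?_) h1)
      · apply Finset.sum_congr rfl
        intro k hk
        have := hK hk
        simp only [f]; rw [if_neg (by omega), sub_zero]
      · simp only [f]; split_ifs; exacts [by simp, by simpa using hp.1 k]
    linarith
  obtain ⟨n, hn, hmin⟩ := Int.exists_least_of_bdd (P := fun m => 1 / 2 ≤ F m) ⟨K, hlow⟩ ⟨M, hup⟩
  have hn1 : F (n - 1) < 1 / 2 := by
    by_contra h
    have := hmin (n - 1) (not_lt.1 h)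
    omega
  have hst := hstep n
  have hxn := hx n
  obtain ⟨m, hm1, hm2⟩ : ∃ m, (1 - x) / 2 ≤ F m ∧ F m ≤ (1 + x) / 2 := by
    by_cases h : (1 - x) / 2 ≤ F (n - 1)
    · exact ⟨n - 1, h, by linarith⟩
    · exact ⟨n, by linarith, by linarith⟩
  have hfn : ∀ k, 0 ≤ f m k := fun k => by
    simp only [f]; split_ifs; exacts [hp.1 k, le_rfl]
  have hgn : ∀ k, 0 ≤ p k - f m k := fun k => by
    simp only [f]; split_ifs; exacts [by simp, by simpa using hp.1 k]
  have hg : HasSum (fun k => p k - f m k) (1 - F m) := hp.2.sub (hF m)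
  obtain ⟨p1, a1, a2, a3⟩ := normalize_aux hfn (hF m) m
  obtain ⟨p2, b1, b2, b3⟩ := normalize_aux hgn hg (m + 1)
  refine ⟨F m, p1, p2, m, ⟨a1, b1, (hF m).nonneg hfn, ?_, fun k => ?_, fun k hk => ?_,
    fun k hk => ?_⟩, hm1, hm2⟩
  · have := hg.nonneg hgn
    linarith
  · rw [← a2, ← b2]; ring
  · exact a3 k (by omega) (by simp only [f]; rw [if_neg (by omega)])
  · exact b3 k (by omega) (by simp only [f]; rw [if_pos hk, sub_self])

/-- objective -/
noncomputable def obj (x y a b : ℝ) : ℝ :=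
  ((1 - x) ^ 2 * a ^ 2 + (1 - y) ^ 2 * b ^ 2) / (8 * Real.log 2)

lemma log2pos : 0 < Real.log 2 := log_pos (by norm_num)

lemma obj_nonneg (x y a b : ℝ) : 0 ≤ obj x y a b := by
  have := log2pos
  unfold obj; positivity

lemma lfun_le {x y a b : ℝ} (h : (a, b) ∈ Tset x y) : lfun x y ≤ obj x y a b :=
  csInf_le ⟨0, by rintro _ ⟨ab, _, rfl⟩; exact obj_nonneg _ _ _ _⟩ ⟨(a, b), h, rfl⟩

lemma Tset_ne {x y : ℝ} (hx : x ∈ Set.Icc (0 : ℝ) 1) (hy : y ∈ Set.Icc (0 : ℝ) 1) :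
    ((2 : ℝ), (2 : ℝ)) ∈ Tset x y := by
  obtain ⟨h1, h2⟩ := hx
  obtain ⟨h3, h4⟩ := hy
  refine ⟨by norm_num, by norm_num, max_le ?_ ?_, max_le ?_ ?_, ?_⟩ <;> simp only [] <;> linarith

lemma le_lfun {x y C : ℝ} (hx : x ∈ Set.Icc (0 : ℝ) 1) (hy : y ∈ Set.Icc (0 : ℝ) 1)
    (h : ∀ a b, (a, b) ∈ Tset x y → C ≤ obj x y a b) : C ≤ lfun x y := by
  refine le_csInf (Set.Nonempty.image _ ⟨_, Tset_ne hx hy⟩) ?_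
  rintro _ ⟨ab, h', rfl⟩
  exact h _ _ h'

lemma lfun_nonneg (x y : ℝ) : 0 ≤ lfun x y :=
  Real.sInf_nonneg (by rintro _ ⟨ab, _, rfl⟩; exact obj_nonneg _ _ _ _)

lemma lfun_zero_iff {x y : ℝ} (hx : x ∈ Set.Icc (0 : ℝ) 1) (hy : y ∈ Set.Icc (0 : ℝ) 1) :
    lfun x y = 0 ↔ x = 1 ∧ y = 1 := by
  have l2 := log2pos
  constructor
  · intro h
    by_contra hne
    obtain ⟨h1, h2⟩ := hx
    obtain ⟨h3, h4⟩ := hy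
    suffices ∃ C, 0 < C ∧ C ≤ lfun x y by
      obtain ⟨C, hC, hC'⟩ := this
      linarith
    rcases h4.eq_or_lt with rfl | hy1
    · have hx1 : x < 1 := lt_of_le_of_ne h2 fun h => hne ⟨h, rfl⟩
      have : 0 < 1 - x := by linarith
      refine ⟨(1 - x) ^ 2 * 2 ^ 2 / (8 * Real.log 2), by positivity,
        le_lfun ⟨h1, h2⟩ ⟨h3, h4⟩ fun a b hab => ?_⟩
      have ha : 2 ≤ a := by
        have := (le_max_left _ _).trans hab.2.2.1
        simp only [] at this; linarith
      unfold obj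
      gcongr
      nlinarith [sq_nonneg b, mul_le_mul_of_nonneg_left (pow_le_pow_left₀ (by norm_num) ha 2) (sq_nonneg (1 - x))]
    · rcases h2.eq_or_lt with rfl | hx1
      · have : 0 < 1 - y := by linarith
        refine ⟨(1 - y) ^ 2 * 2 ^ 2 / (8 * Real.log 2), by positivity,
          le_lfun ⟨h1, h2⟩ ⟨h3, h4⟩ fun a b hab => ?_⟩
        have hb : 2 ≤ b := by
          have := (le_max_left _ _).trans hab.2.2.2.1
          simp only [] at this; linarith
        unfold obj
        gcongr
        nlinarith [sq_nonneg b, mul_le_mul_of_nonneg_left (pow_le_pow_left₀ (by norm_num) hb 2) (sq_nonneg (1 - y))]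
      · have k1 : 0 < 1 - x := by linarith
        have k2 : 0 < 1 - y := by linarith
        have k3 : 0 < 2 - x - y := by linarith
        refine ⟨((1 - x) * (1 - y)) ^ 2 * ((2 - x - y) / 2) ^ 2 / (8 * Real.log 2), by positivity,
          le_lfun ⟨h1, h2⟩ ⟨h3, h4⟩ fun a b hab => ?_⟩
        have hs : 2 - x - y ≤ a + b := hab.2.2.2.2
        have hy2 : (1 - y) ^ 2 ≤ 1 := by nlinarith
        have hx2 : (1 - x) ^ 2 ≤ 1 := by nlinarith
        have hsq : ((2 - x - y) / 2) ^ 2 ≤ a ^ 2 + b ^ 2 := by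
          have : (2 - x - y) ^ 2 ≤ (a + b) ^ 2 := pow_le_pow_left₀ k3.le hs 2
          nlinarith [sq_nonneg (a - b), sq_nonneg (a + b)]
        unfold obj
        gcongr
        calc ((1 - x) * (1 - y)) ^ 2 * ((2 - x - y) / 2) ^ 2
            ≤ ((1 - x) * (1 - y)) ^ 2 * (a ^ 2 + b ^ 2) := by gcongr
          _ = ((1 - x) ^ 2 * a ^ 2) * (1 - y) ^ 2 + ((1 - y) ^ 2 * b ^ 2) * (1 - x) ^ 2 := by ring
          _ ≤ ((1 - x) ^ 2 * a ^ 2) * 1 + ((1 - y) ^ 2 * b ^ 2) * 1 := by gcongr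
          _ = _ := by ring
  · rintro ⟨rfl, rfl⟩
    apply le_antisymm _ (lfun_nonneg _ _)
    refine (lfun_le (Tset_ne hx hy)).trans (le_of_eq ?_)
    simp [obj]

noncomputable def Fpar (xy : ℝ × ℝ) (t : ℝ) : ℝ :=
  obj xy.1 xy.2 (max (max (4 * xy.2 - 2) 0) t)
    (max (max (4 * xy.1 - 2) 0) (2 - xy.1 - xy.2 - max (max (4 * xy.2 - 2) 0) t))

lemma obj_mono {x y a b a' b' : ℝ} (ha : 0 ≤ a) (hb : 0 ≤ b) (h : a ≤ a') (h' : b ≤ b') :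
    obj x y a b ≤ obj x y a' b' := by
  have := log2pos
  unfold obj
  gcongr

lemma lfun_eq {xy : ℝ × ℝ} (hxy : xy ∈ Set.Icc (0 : ℝ) 1 ×ˢ Set.Icc (0 : ℝ) 1) :
    lfun xy.1 xy.2 = sInf (Fpar xy '' Set.Icc 0 2) := by
  obtain ⟨x, y⟩ := xy
  obtain ⟨⟨h1, h2⟩, ⟨h3, h4⟩⟩ := hxy
  simp only [] at *
  apply le_antisymm
  · refine le_csInf (Set.Nonempty.image _ ⟨0, by simp⟩) ?_
    rintro _ ⟨t, ht, rfl⟩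
    unfold Fpar
    apply lfun_le
    refine ⟨?_, ?_, le_max_left _ _, le_max_left _ _, ?_⟩
    · exact (le_max_right _ _).trans (le_max_left _ _)
    · exact (le_max_right _ _).trans (le_max_left _ _)
    · have := le_max_right (max (4 * x - 2) 0) (2 - x - y - max (max (4 * y - 2) 0) t)
      simp only [] at *
      linarith
  · apply le_lfun ⟨h1, h2⟩ ⟨h3, h4⟩
    rintro a b ⟨ha, hb, hA, hB, hs⟩
    simp only [] at *
    have hle : sInf (Fpar (x, y) '' Set.Icc 0 2) ≤ Fpar (x, y) (min a 2) :=
      csInf_le ⟨0, by rintro _ ⟨t, _, rfl⟩; exact obj_nonneg _ _ _ _⟩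
        ⟨min a 2, ⟨le_min ha (by norm_num), min_le_right _ _⟩, rfl⟩
    refine hle.trans ?_
    unfold Fpar
    have hA2 : max (4 * y - 2) 0 ≤ min a 2 := le_min hA (max_le (by linarith) (by norm_num))
    have e : max (max (4 * y - 2) 0) (min a 2) = min a 2 := max_eq_right hA2
    simp only [e]
    apply obj_mono (le_min ha (by norm_num)) ((le_max_right _ _).trans (le_max_left _ _))
      (min_le_left _ _)
    apply max_le hB
    rcases min_cases a 2 with ⟨h, _⟩ | ⟨h, _⟩ <;> rw [h] <;> linarith

lemma lfun_cont : ContinuousOn (fun xy : ℝ × ℝ => lfun xy.1 xy.2)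
    (Set.Icc (0 : ℝ) 1 ×ˢ Set.Icc (0 : ℝ) 1) := by
  have : Continuous fun xy : ℝ × ℝ => sInf (Fpar xy '' Set.Icc 0 2) := by
    apply IsCompact.continuous_sInf isCompact_Icc
    show Continuous fun z : (ℝ × ℝ) × ℝ => Fpar z.1 z.2
    unfold Fpar obj
    fun_prop
  exact this.continuousOn.congr fun xy h => lfun_eq h

lemma coef {x α a L : ℝ} (hx0 : 0 ≤ x) (hx1 : x ≤ 1) (ha : (1 - x) / 2 ≤ α)
    (ha' : α ≤ (1 + x) / 2) (h : α * (1 - α) * a ^ 2 / 2 ≤ L) : (1 - x) ^ 2 * a ^ 2 / 8 ≤ L := by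
  refine le_trans ?_ h
  have : (1 - x) ^ 2 / 4 ≤ α * (1 - α) := by nlinarith
  nlinarith [mul_le_mul_of_nonneg_right this (sq_nonneg a)]

lemma main_ineq (p q : ℤ → ℝ) (c d x y : ℝ) (hp : IsPMF p) (hq : IsPMF q)
    (hc : HasSum (fun k => -(p k * Real.logb 2 (p k))) c)
    (hd : HasSum (fun k => -(q k * Real.logb 2 (q k))) d)
    (hx : x = ⨆ i, p i) (hy : y = ⨆ i, q i) :
    2 * entH (conv p q) - c - d ≥ lfun x y := by
  have l2 := log2pos
  have conv_log : ∀ t : ℝ, negMulLog t = -(t * Real.logb 2 t) * Real.log 2 := fun t => by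
    unfold negMulLog Real.logb; field_simp
  have hc' : HasSum (fun k => negMulLog (p k)) (c * Real.log 2) := by
    simp only [conv_log]; exact hc.mul_right _
  have hd' : HasSum (fun k => negMulLog (q k)) (d * Real.log 2) := by
    simp only [conv_log]; exact hd.mul_right _
  have hs := conv_eta_upper hp hq hc' hd'
  have hE : ∑' k, negMulLog (conv p q k) = entH (conv p q) * Real.log 2 := by
    simp only [conv_log, entH]; exact tsum_mul_right
  have bx : BddAbove (Set.range p) := ⟨1, by rintro _ ⟨k, rfl⟩; exact pmf_le_one hp k⟩
  have bddY : BddAbove (Set.range q) := ⟨1, by rintro _ ⟨k, rfl⟩; exact pmf_le_one hq k⟩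
  have hpx : ∀ k, p k ≤ x := fun k => hx ▸ le_ciSup bx k
  have hqy : ∀ k, q k ≤ y := fun k => hy ▸ le_ciSup bddY k
  have x0 : 0 ≤ x := (hp.1 0).trans (hpx 0)
  have y0 : 0 ≤ y := (hq.1 0).trans (hqy 0)
  have x1 : x ≤ 1 := hx ▸ ciSup_le (pmf_le_one hp)
  have y1 : y ≤ 1 := hy ▸ ciSup_le (pmf_le_one hq)
  obtain ⟨α, p1, p2, m, S, ha, ha'⟩ := exists_split hp hpx
  obtain ⟨β, q1, q2, n, T, hb, hb'⟩ := exists_split hq hqy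
  have d1 := coef x0 x1 ha ha' (ent_diff hp hq S hd' hs)
  have d2 := coef y0 y1 hb hb' (ent_diff hq hp T hc' (by rwa [conv_comm' q p]))
  have hsum := L1_sum hp hq S T ha ha' hb hb'
  rw [conv_comm' q p] at d2
  rw [hE] at d1 d2
  set a := L1 (conv p1 q) (conv p2 q) with hadef
  set b := L1 (conv q1 p) (conv q2 p) with hbdef
  have a0 : 0 ≤ a := tsum_nonneg fun _ => abs_nonneg _
  have b0 : 0 ≤ b := tsum_nonneg fun _ => abs_nonneg _
  have aY : 4 * y - 2 ≤ a := by
    have : y ≤ (a + 2) / 4 := hy ▸ ciSup_le fun j => by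
      have := EN_spike S hq j
      linarith
    linarith
  have bX : 4 * x - 2 ≤ b := by
    have : x ≤ (b + 2) / 4 := hx ▸ ciSup_le fun j => by
      have := EN_spike T hp j
      linarith
    linarith
  refine ge_iff_le.2 ((lfun_le (a := a) (b := b) ⟨a0, b0, max_le aY a0, max_le bX b0, hsum⟩).trans ?_)
  unfold obj
  rw [div_le_iff₀ (by positivity)]
  nlinarith

/-- if `H(p) = c`, `H(q) = d` are finite, `x = ‖p‖_∞`, `y = ‖q‖_∞`, then
`2·H(p⋆q) − c − d ≥ l(x,y)`; moreover `l` is continuous on `[0,1]²`, nonnegative there, and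
vanishes exactly at `(1,1)`. -/
theorem stmt15 (p q : ℤ → ℝ) (c d x y : ℝ) (hp : IsPMF p) (hq : IsPMF q)
    (hc : HasSum (fun k => -(p k * Real.logb 2 (p k))) c)
    (hd : HasSum (fun k => -(q k * Real.logb 2 (q k))) d)
    (hx : x = ⨆ i, p i) (hy : y = ⨆ i, q i) :
    2 * entH (conv p q) - c - d ≥ lfun x y ∧
    ContinuousOn (fun xy : ℝ × ℝ => lfun xy.1 xy.2) (Set.Icc (0 : ℝ) 1 ×ˢ Set.Icc (0 : ℝ) 1) ∧
    (∀ x' y' : ℝ, x' ∈ Set.Icc (0 : ℝ) 1 → y' ∈ Set.Icc (0 : ℝ) 1 → 0 ≤ lfun x' y') ∧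
    (∀ x' y' : ℝ, x' ∈ Set.Icc (0 : ℝ) 1 → y' ∈ Set.Icc (0 : ℝ) 1 →
      (lfun x' y' = 0 ↔ x' = 1 ∧ y' = 1)) := by
  exact ⟨main_ineq p q c d x y hp hq hc hd hx hy, lfun_cont, fun x' y' _ _ => lfun_nonneg x' y',
    fun x' y' h1 h2 => lfun_zero_iff h1 h2⟩
end
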